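/- arXiv:1704.07997 — 3 statements merged into one kernel-verified Lean document; each statement's English description precedes it below -/
import Mathlib

section
/- Let n ≥ 1 and let μ be a nonnegative Carleson measure on ℝ^{n+1}_+ = ℝⁿ × (0,∞). Define a measure ν on ℝ^{n+1}_+ by ν(E) = (1/√π) ∫_0^∞ [ ∫_{ℝ^{n+1}_+} 1_E(y,s) · (t/s²) e^{−t²/(4s²)} dμ(y,t) ] ds for Borel sets E ⊆ ℝ^{n+1}_+. Then ν is a Carleson measure and |||ν|||_c ≤ C(n) |||μ|||_c, with C(n) depending only on n. -/
open MeasureTheory Metric Real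

noncomputable section

/-- Euclidean space `ℝⁿ`. -/
abbrev Rn (n : ℕ) := EuclideanSpace ℝ (Fin n)

/-- The closed cube with center `x` and sidelength `l`, sides parallel to the axes. -/
def cube (n : ℕ) (x : Rn n) (l : ℝ) : Set (Rn n) :=
  {y | ∀ i, |y i - x i| ≤ l / 2}

/-- The Carleson box `Q̂` over the cube with center `x` and sidelength `l`. -/
def carlesonBox (n : ℕ) (x : Rn n) (l : ℝ) : Set (Rn n × ℝ) :=
  {p | p.1 ∈ cube n x l ∧ 0 < p.2 ∧ p.2 < l}

/-- The subordinated set function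
`ν(E) = (1/√π) ∫_0^∞ ∫ 1_E(y,s) (t/s²) e^{-t²/(4s²)} dμ(y,t) ds`. -/
def subordinated (n : ℕ) (μ : Measure (Rn n × ℝ)) (E : Set (Rn n × ℝ)) : ENNReal :=
  ENNReal.ofReal (1 / Real.sqrt π) *
    ∫⁻ s in Set.Ioi (0 : ℝ),
      ∫⁻ p : Rn n × ℝ,
        E.indicator (1 : Rn n × ℝ → ENNReal) (p.1, s) *
          ENNReal.ofReal (p.2 / s ^ 2 * Real.exp (-(p.2 ^ 2) / (4 * s ^ 2))) ∂μ

/-- The subordination kernel decays like an arbitrary odd power of `s / t`. -/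
lemma subordination_kernel_le (m : ℕ) {s t : ℝ} (hs : 0 < s) (ht : 0 < t) :
    t / s ^ 2 * Real.exp (-(t ^ 2) / (4 * s ^ 2)) ≤
      (m + 1).factorial * 4 ^ (m + 1) * s ^ (2 * m) / t ^ (2 * m + 1) := by
  have hx : 0 < t ^ 2 / (4 * s ^ 2) := by positivity
  have h := Real.pow_div_factorial_le_exp (t ^ 2 / (4 * s ^ 2)) hx.le (m + 1)
  have hf : (0 : ℝ) < (m + 1).factorial := by positivity
  have he : Real.exp (-(t ^ 2) / (4 * s ^ 2)) ≤
      ((t ^ 2 / (4 * s ^ 2)) ^ (m + 1) / (m + 1).factorial)⁻¹ := by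
    rw [neg_div, Real.exp_neg]
    exact inv_anti₀ (by positivity) h
  calc t / s ^ 2 * Real.exp (-(t ^ 2) / (4 * s ^ 2))
      ≤ t / s ^ 2 * ((t ^ 2 / (4 * s ^ 2)) ^ (m + 1) / (m + 1).factorial)⁻¹ := by gcongr
    _ = (m + 1).factorial * 4 ^ (m + 1) * s ^ (2 * m) / t ^ (2 * m + 1) := by
      rw [div_pow, mul_pow, ← pow_mul, ← pow_mul]
      field_simp
      ring

lemma lintegral_subordination_kernel_le {t : ℝ} (ht : 0 < t) :
    ∫⁻ s in Set.Ioi (0 : ℝ),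
      ENNReal.ofReal (t / s ^ 2 * Real.exp (-(t ^ 2) / (4 * s ^ 2))) ≤ 5 := by
  have hnear : ∫⁻ s in Set.Ioc (0 : ℝ) t,
      ENNReal.ofReal (t / s ^ 2 * Real.exp (-(t ^ 2) / (4 * s ^ 2))) ≤ 4 := by
    calc _ ≤ ∫⁻ _ in Set.Ioc (0 : ℝ) t, ENNReal.ofReal (4 / t) := by
          refine setLIntegral_mono' measurableSet_Ioc fun s hs => ENNReal.ofReal_le_ofReal ?_
          simpa using subordination_kernel_le 0 hs.1 ht
      _ = 4 := by
          rw [setLIntegral_const, Real.volume_Ioc, ← ENNReal.ofReal_mul (by positivity), sub_zero,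
            div_mul_cancel₀ _ ht.ne']
          simp
  have hfar : ∫⁻ s in Set.Ioi t,
      ENNReal.ofReal (t / s ^ 2 * Real.exp (-(t ^ 2) / (4 * s ^ 2))) ≤ 1 := by
    have hint : IntegrableOn (fun s : ℝ => t * s ^ (-2 : ℝ)) (Set.Ioi t) :=
      (integrableOn_Ioi_rpow_of_lt (by norm_num) ht).const_mul t
    calc _ ≤ ∫⁻ s in Set.Ioi t, ENNReal.ofReal (t * s ^ (-2 : ℝ)) := by
          refine setLIntegral_mono' measurableSet_Ioi fun s hs => ENNReal.ofReal_le_ofReal ?_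
          have hs0 : 0 < s := ht.trans hs
          rw [Real.rpow_neg hs0.le, Real.rpow_two, ← div_eq_mul_inv]
          refine mul_le_of_le_one_right (by positivity) (Real.exp_le_one_iff.2 ?_)
          rw [neg_div]
          exact neg_nonpos.2 (by positivity)
      _ = ENNReal.ofReal (∫ s in Set.Ioi t, t * s ^ (-2 : ℝ)) := by
          refine (ofReal_integral_eq_lintegral_ofReal hint ?_).symm
          refine (ae_restrict_iff' measurableSet_Ioi).2 (.of_forall fun s hs => ?_)
          have hs0 : 0 < s := ht.trans hs
          simp only [Pi.zero_apply]
          positivity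
      _ = 1 := by
          rw [integral_const_mul, integral_Ioi_rpow_of_lt (by norm_num) ht]
          norm_num
          rw [Real.rpow_neg_one, mul_inv_cancel₀ ht.ne']
  rw [← Set.Ioc_union_Ioi_eq_Ioi ht.le]
  calc _ ≤ _ := lintegral_union_le _ _ _
    _ ≤ 4 + 1 := add_le_add hnear hfar
    _ = 5 := by norm_num

lemma measurableSet_cube (n : ℕ) (x : Rn n) (l : ℝ) : MeasurableSet (cube n x l) := by
  refine IsClosed.measurableSet ?_
  simp only [cube, Set.ofPred_forall]
  exact isClosed_iInter fun i => isClosed_le (by fun_prop) continuous_const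

lemma measurableSet_carlesonBox (n : ℕ) (x : Rn n) (l : ℝ) :
    MeasurableSet (carlesonBox n x l) :=
  (measurable_fst (measurableSet_cube n x l)).inter (measurable_snd measurableSet_Ioo)

lemma cube_subset_cube (n : ℕ) (x : Rn n) {l l' : ℝ} (h : l ≤ l') :
    cube n x l ⊆ cube n x l' :=
  fun _ hy i => (hy i).trans (by linarith)

/-- The part of the `k`-th dyadic dilate of a Carleson box at height at least `2 ^ k * l`. -/
def dyadicSlab (n : ℕ) (x : Rn n) (l : ℝ) (k : ℕ) : Set (Rn n × ℝ) :=
  carlesonBox n x (2 ^ (k + 1) * l) ∩ {p | 2 ^ k * l ≤ p.2}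

lemma measurableSet_dyadicSlab (n : ℕ) (x : Rn n) (l : ℝ) (k : ℕ) :
    MeasurableSet (dyadicSlab n x l k) :=
  (measurableSet_carlesonBox n x _).inter (measurableSet_le measurable_const measurable_snd)

lemma mem_carlesonBox_or_exists_mem_dyadicSlab {n : ℕ} {x : Rn n} {l : ℝ} (hl : 0 < l)
    {p : Rn n × ℝ} (hp : p.1 ∈ cube n x l) (ht : 0 < p.2) :
    p ∈ carlesonBox n x l ∨ ∃ k, p ∈ dyadicSlab n x l k := by
  rcases lt_or_ge p.2 l with h | h
  · exact .inl ⟨hp, ht, h⟩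
  · obtain ⟨k, hk, hk'⟩ := exists_nat_pow_near ((one_le_div hl).2 h) one_lt_two
    rw [le_div_iff₀ hl] at hk
    rw [div_lt_iff₀ hl] at hk'
    refine .inr ⟨k, ⟨cube_subset_cube n x ?_ hp, ht, hk'⟩, hk⟩
    exact le_mul_of_one_le_left hl.le (one_le_pow₀ one_le_two)

lemma lintegral_dyadicSlab_le {n : ℕ} {μ : Measure (Rn n × ℝ)} {M : ℝ} (hM : 0 ≤ M)
    (hμ : ∀ x l, 0 < l → μ (carlesonBox n x l) ≤ ENNReal.ofReal (M * l ^ n))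
    (x : Rn n) {l s : ℝ} (hl : 0 < l) (hs : 0 < s) (hsl : s < l) (k : ℕ) :
    ∫⁻ p in dyadicSlab n x l k,
        ENNReal.ofReal (p.2 / s ^ 2 * Real.exp (-(p.2 ^ 2) / (4 * s ^ 2))) ∂μ ≤
      ENNReal.ofReal ((n + 1).factorial * 4 ^ (n + 1) * 2 ^ n * M * l ^ n / l * (1 / 2) ^ k) := by
  set D : ℝ := (n + 1).factorial * 4 ^ (n + 1) with hD
  have hD0 : 0 ≤ D := by positivity
  calc _ ≤ ∫⁻ _ in dyadicSlab n x l k,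
        ENNReal.ofReal (D * l ^ (2 * n) / (2 ^ k * l) ^ (2 * n + 1)) ∂μ := by
        refine setLIntegral_mono' (measurableSet_dyadicSlab n x l k) fun p hp =>
          ENNReal.ofReal_le_ofReal ((subordination_kernel_le n hs hp.1.2.1).trans ?_)
        have h2 : 2 ^ k * l ≤ p.2 := hp.2
        rw [← hD]
        gcongr
    _ = ENNReal.ofReal (D * l ^ (2 * n) / (2 ^ k * l) ^ (2 * n + 1)) *
          μ (dyadicSlab n x l k) := setLIntegral_const _ _
    _ ≤ ENNReal.ofReal (D * l ^ (2 * n) / (2 ^ k * l) ^ (2 * n + 1)) *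
          ENNReal.ofReal (M * (2 ^ (k + 1) * l) ^ n) := by
        gcongr
        exact (measure_mono Set.inter_subset_left).trans (hμ _ _ (by positivity))
    _ ≤ _ := by
        rw [← ENNReal.ofReal_mul (by positivity)]
        refine ENNReal.ofReal_le_ofReal ?_
        have key : D * l ^ (2 * n) / (2 ^ k * l) ^ (2 * n + 1) * (M * (2 ^ (k + 1) * l) ^ n) =
            D * 2 ^ n * M * l ^ n / l * ((1 / 2) ^ k * (1 / (2 ^ k) ^ n)) := by
          rw [pow_succ (2 : ℝ) k, one_div_pow]
          have ha : (2 : ℝ) ^ k ≠ 0 := by positivity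
          generalize (2 : ℝ) ^ k = a at ha ⊢
          simp only [mul_pow, pow_succ, two_mul, pow_add]
          field_simp
        rw [key]
        gcongr
        refine mul_le_of_le_one_right (by positivity) ?_
        rw [div_le_one (by positivity)]
        exact one_le_pow₀ (one_le_pow₀ one_le_two)

lemma lintegral_lintegral_carlesonBox_le {n : ℕ} {μ : Measure (Rn n × ℝ)} {x : Rn n} {l : ℝ}
    (hfin : μ (carlesonBox n x l) < ⊤) :
    ∫⁻ s in Set.Ioi (0 : ℝ), ∫⁻ p in carlesonBox n x l,
        ENNReal.ofReal (p.2 / s ^ 2 * Real.exp (-(p.2 ^ 2) / (4 * s ^ 2))) ∂μ ≤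
      5 * μ (carlesonBox n x l) := by
  have : IsFiniteMeasure (μ.restrict (carlesonBox n x l)) := ⟨by simpa using hfin⟩
  rw [lintegral_lintegral_swap (by fun_prop), ← setLIntegral_const]
  exact setLIntegral_mono' (measurableSet_carlesonBox n x l) fun p hp =>
    lintegral_subordination_kernel_le hp.2.1

/-- At scales `s < l`, the part of `μ` above the Carleson box contributes at most a constant. -/
lemma lintegral_indicator_carlesonBox_le {n : ℕ} {μ : Measure (Rn n × ℝ)} {M : ℝ} (hM : 0 ≤ M)
    (hpos : μ {p : Rn n × ℝ | p.2 ≤ 0} = 0)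
    (hμ : ∀ x l, 0 < l → μ (carlesonBox n x l) ≤ ENNReal.ofReal (M * l ^ n))
    (x : Rn n) {l s : ℝ} (hl : 0 < l) (hs : 0 < s) :
    ∫⁻ p : Rn n × ℝ, (carlesonBox n x l).indicator (1 : Rn n × ℝ → ENNReal) (p.1, s) *
        ENNReal.ofReal (p.2 / s ^ 2 * Real.exp (-(p.2 ^ 2) / (4 * s ^ 2))) ∂μ ≤
      (∫⁻ p in carlesonBox n x l,
        ENNReal.ofReal (p.2 / s ^ 2 * Real.exp (-(p.2 ^ 2) / (4 * s ^ 2))) ∂μ) +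
      (Set.Ioo 0 l).indicator (fun _ => ENNReal.ofReal
        (2 * ((n + 1).factorial * 4 ^ (n + 1) * 2 ^ n * M * l ^ n / l))) s := by
  by_cases hsl : s < l
  · rw [Set.indicator_of_mem (show s ∈ Set.Ioo 0 l from ⟨hs, hsl⟩)]
    set g : Rn n × ℝ → ENNReal := fun p =>
      ENNReal.ofReal (p.2 / s ^ 2 * Real.exp (-(p.2 ^ 2) / (4 * s ^ 2)))
    set U : Set (Rn n × ℝ) := ⋃ k, dyadicSlab n x l k with hU
    have hmeas : MeasurableSet (carlesonBox n x l ∪ U) :=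
      (measurableSet_carlesonBox n x l).union (.iUnion (measurableSet_dyadicSlab n x l))
    have hae : ∀ᵐ p ∂μ, 0 < p.2 := by
      rw [ae_iff]
      simpa using hpos
    calc _ ≤ ∫⁻ p, (carlesonBox n x l ∪ U).indicator g p ∂μ := by
          refine lintegral_mono_ae (hae.mono fun p hp => ?_)
          by_cases hmem : (p.1, s) ∈ carlesonBox n x l
          · have hpU : p ∈ carlesonBox n x l ∪ U := by
              rw [hU, Set.mem_union, Set.mem_iUnion]
              exact mem_carlesonBox_or_exists_mem_dyadicSlab hl hmem.1 hp
            rw [Set.indicator_of_mem hmem, Set.indicator_of_mem hpU]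
            simp [g]
          · simp [Set.indicator_of_notMem hmem]
      _ = ∫⁻ p in carlesonBox n x l ∪ U, g p ∂μ := lintegral_indicator hmeas _
      _ ≤ (∫⁻ p in carlesonBox n x l, g p ∂μ) + ∫⁻ p in U, g p ∂μ := lintegral_union_le _ _ _
      _ ≤ _ := by
          gcongr
          refine (lintegral_iUnion_le _ _).trans ?_
          refine (ENNReal.tsum_le_tsum fun k =>
            lintegral_dyadicSlab_le hM hμ x hl hs hsl k).trans_eq ?_
          rw [← ENNReal.ofReal_tsum_of_nonneg (fun k => by positivity)
            (summable_geometric_two.mul_left _), tsum_mul_left, tsum_geometric_two, mul_comm]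
  · have h0 : ∀ p : Rn n × ℝ, (p.1, s) ∉ carlesonBox n x l := fun p hp => hsl hp.2.2
    simp [h0]


/-- If `μ` is a nonnegative Carleson measure on the upper half-space, then the measure
`ν` obtained from `μ` by subordination is a Carleson measure with
`|||ν|||_c ≤ C(n) |||μ|||_c`. -/
theorem subordinated_carleson (n : ℕ) (hn : 1 ≤ n) :
    ∃ C > 0, ∀ (μ : Measure (Rn n × ℝ)) (M : ℝ), 0 ≤ M →
      μ {p : Rn n × ℝ | p.2 ≤ 0} = 0 →
      (∀ x l, 0 < l → μ (carlesonBox n x l) ≤ ENNReal.ofReal (M * l ^ n)) →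
      ∀ x₀ l, 0 < l →
        subordinated n μ (carlesonBox n x₀ l) ≤ ENNReal.ofReal (C * M * l ^ n) := by
  set D : ℝ := (n + 1).factorial * 4 ^ (n + 1) * 2 ^ n with hD
  have hD0 : 0 < D := by positivity
  refine ⟨5 + 2 * D, by positivity, fun μ M hM hpos hμ x l hl => ?_⟩
  have hbox := hμ x l hl
  have hsqrt : ENNReal.ofReal (1 / Real.sqrt π) ≤ 1 := by
    rw [ENNReal.ofReal_le_one, div_le_one (by positivity), Real.one_le_sqrt]
    linarith [Real.pi_gt_three]
  calc subordinated n μ (carlesonBox n x l)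
      ≤ 1 * ∫⁻ s in Set.Ioi (0 : ℝ), ((∫⁻ p in carlesonBox n x l,
          ENNReal.ofReal (p.2 / s ^ 2 * Real.exp (-(p.2 ^ 2) / (4 * s ^ 2))) ∂μ) +
          (Set.Ioo 0 l).indicator (fun _ => ENNReal.ofReal (2 * (D * M * l ^ n / l))) s) :=
        mul_le_mul' hsqrt (setLIntegral_mono' measurableSet_Ioi fun s hs =>
          lintegral_indicator_carlesonBox_le hM hpos hμ x hl hs)
    _ ≤ 5 * ENNReal.ofReal (M * l ^ n) + ENNReal.ofReal (2 * (D * M * l ^ n / l)) *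
          ENNReal.ofReal l := by
        rw [one_mul, lintegral_add_right _ (measurable_const.indicator measurableSet_Ioo)]
        refine add_le_add ((lintegral_lintegral_carlesonBox_le
          (hbox.trans_lt ENNReal.ofReal_lt_top)).trans (by gcongr)) ?_
        refine (setLIntegral_le_lintegral _ _).trans_eq ?_
        rw [lintegral_indicator measurableSet_Ioo, setLIntegral_const, Real.volume_Ioo, sub_zero]
    _ = ENNReal.ofReal ((5 + 2 * D) * M * l ^ n) := by
        rw [show (5 : ENNReal) = ENNReal.ofReal 5 by simp, ← ENNReal.ofReal_mul (by norm_num),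
          ← ENNReal.ofReal_mul (by positivity), ← ENNReal.ofReal_add (by positivity)
          (by positivity)]
        congr 1
        field_simp
end
end

section
/- Let n ≥ 3 and let V ∈ B_q for some q > n/2 be nonnegative and not almost everywhere zero, with critical radius function ρ. Then there exist constants C > 0 and k₀ ≥ 1 such that for all x, y ∈ ℝⁿ: C^{−1} ρ(x) (1 + |x−y|/ρ(x))^{−k₀} ≤ ρ(y) ≤ C ρ(x) (1 + |x−y|/ρ(x))^{k₀/(k₀+1)}. -/
open MeasureTheory Metric Real

noncomputable section

/-- `V` belongs to the reverse Hölder class `B_q`: `V` is nonnegative, `V^q` is locally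
integrable, and the reverse Hölder inequality holds on every ball. -/
def IsReverseHolder (n : ℕ) (V : Rn n → ℝ) (q : ℝ) : Prop :=
  (∀ y, 0 ≤ V y) ∧
  (∀ (x : Rn n) (r : ℝ), 0 < r → IntegrableOn (fun y => V y ^ q) (ball x r) volume) ∧
  ∃ C > 0, ∀ (x : Rn n) (r : ℝ), 0 < r →
    ((volume (ball x r)).toReal⁻¹ * ∫ y in ball x r, V y ^ q) ^ (1 / q) ≤
      C * (volume (ball x r)).toReal⁻¹ * ∫ y in ball x r, V y

/-- The set of admissible radii in the definition of the critical radius function. -/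
def critSet (n : ℕ) (V : Rn n → ℝ) (x : Rn n) : Set ℝ :=
  {r : ℝ | 0 < r ∧ r ^ ((2 : ℝ) - n) * ∫ y in ball x r, V y ≤ 1}

/-- The critical radius function `ρ(x)` associated to the potential `V`. -/
def critRho (n : ℕ) (V : Rn n → ℝ) (x : Rn n) : ℝ :=
  sSup (critSet n V x)

/-- The radius `R * (C * K) ^ (-(1 / (β - α)))` is admissible once `F R ≤ K * R ^ α`. -/
lemma growth_admissible {F : ℝ → ℝ} {α β C K R : ℝ} (hαβ : α < β) (hC : 1 ≤ C) (hK : 1 ≤ K)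
    (hA : ∀ r R, 0 < r → r ≤ R → F r ≤ C * (r / R) ^ β * F R)
    (hR : 0 < R) (hF : F R ≤ K * R ^ α) :
    0 < R * (C * K) ^ (-(1 / (β - α))) ∧
      F (R * (C * K) ^ (-(1 / (β - α)))) ≤ (R * (C * K) ^ (-(1 / (β - α)))) ^ α := by
  have hγ : 0 < β - α := sub_pos.2 hαβ
  have hCK : 1 ≤ C * K := one_le_mul_of_one_le_of_one_le hC hK
  have hCK0 : 0 < C * K := by linarith
  set s : ℝ := (C * K) ^ (-(1 / (β - α))) with hs
  have hs0 : 0 < s := rpow_pos_of_pos hCK0 _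
  have hs1 : s ≤ 1 := rpow_le_one_of_one_le_of_nonpos hCK (by
    have : 0 < 1 / (β - α) := by positivity
    linarith)
  have hsγ : s ^ (β - α) = (C * K)⁻¹ := by
    rw [hs, ← rpow_mul hCK0.le, neg_mul, one_div_mul_cancel hγ.ne', rpow_neg_one]
  have hsβ : s ^ β = (C * K)⁻¹ * s ^ α := by
    rw [← hsγ, ← rpow_add hs0]; congr 1; ring
  refine ⟨by positivity, (hA (R * s) R (by positivity) (by nlinarith)).trans ?_⟩
  rw [mul_div_cancel_left₀ _ hR.ne', mul_rpow hR.le hs0.le]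
  calc C * s ^ β * F R ≤ C * s ^ β * (K * R ^ α) := by gcongr
    _ = R ^ α * s ^ α := by
      rw [hsβ]; field_simp

/-- Power growth makes the set of admissible radii bounded above. -/
lemma bddAbove_admissible {F : ℝ → ℝ} {α β C : ℝ} (hαβ : α < β)
    (hA : ∀ r R, 0 < r → r ≤ R → F r ≤ C * (r / R) ^ β * F R) (hC : 1 ≤ C) (hF : 0 < F 1) :
    BddAbove {r : ℝ | 0 < r ∧ F r ≤ r ^ α} := by
  have hγ : 0 < β - α := sub_pos.2 hαβ
  refine ⟨max 1 ((C / F 1) ^ (1 / (β - α))), ?_⟩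
  rintro r ⟨hr, hr'⟩
  rcases le_total r 1 with h1 | h1
  · exact h1.trans (le_max_left _ _)
  refine le_trans ?_ (le_max_right _ _)
  have h := hA 1 r one_pos h1
  have h2 : F 1 ≤ C * (1 / r) ^ β * r ^ α := h.trans (by gcongr)
  have h3 : r ^ (β - α) ≤ C / F 1 := by
    rw [le_div_iff₀ hF, rpow_sub hr]
    rw [one_div, inv_rpow hr.le] at h2
    have hb : 0 < r ^ β := rpow_pos_of_pos hr _
    have ha : 0 < r ^ α := rpow_pos_of_pos hr _
    calc r ^ β / r ^ α * F 1 ≤ r ^ β / r ^ α * (C * (r ^ β)⁻¹ * r ^ α) := by gcongr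
      _ = C := by field_simp
  calc r = (r ^ (β - α)) ^ (1 / (β - α)) := by
        rw [← rpow_mul hr.le, mul_one_div_cancel hγ.ne', rpow_one]
    _ ≤ _ := by gcongr

/-- The upper comparison follows from the lower one with the two points interchanged. -/
lemma upper_of_lower {A k s u d : ℝ} (hA : 1 ≤ A) (hk : 1 ≤ k) (hs : 0 < s) (hu : 0 < u)
    (hd : 0 ≤ d) (h : A⁻¹ * s * (1 + d / s) ^ (-k) ≤ u) :
    s ≤ A * 2 ^ k * u * (1 + d / u) ^ (k / (k + 1)) := by
  have ht : 1 ≤ 1 + d / u := by have : 0 ≤ d / u := by positivity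
                                linarith
  have hw : 0 < 1 + d / s := by positivity
  have h' : s ≤ A * u * (1 + d / s) ^ k := by
    rw [rpow_neg hw.le] at h
    have hp : 0 < (1 + d / s) ^ k := rpow_pos_of_pos hw _
    calc s = A * (A⁻¹ * s * ((1 + d / s) ^ k)⁻¹) * (1 + d / s) ^ k := by field_simp
      _ ≤ _ := by gcongr
  have hE : 1 ≤ A * 2 ^ k :=
    one_le_mul_of_one_le_of_one_le hA (one_le_rpow one_le_two (by linarith))
  rcases le_total d s with hds | hds
  · have h2 : 1 + d / s ≤ 2 := by
      have : d / s ≤ 1 := (div_le_one hs).2 hds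
      linarith
    calc s ≤ A * u * (1 + d / s) ^ k := h'
      _ ≤ A * u * 2 ^ k := by gcongr
      _ = A * 2 ^ k * u * 1 := by ring
      _ ≤ _ := by
        gcongr
        exact one_le_rpow ht (by positivity)
  · have h2 : 1 + d / s ≤ 2 * (d / s) := by
      have : 1 ≤ d / s := (one_le_div hs).2 hds
      linarith
    have hsk : 0 < s ^ k := rpow_pos_of_pos hs _
    have huk : 0 < u ^ k := rpow_pos_of_pos hu _
    have h3 : s ^ (k + 1) ≤ (A * 2 ^ k) * (u ^ (k + 1) * (1 + d / u) ^ k) := by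
      rw [rpow_add_one hs.ne', rpow_add_one hu.ne']
      calc s ^ k * s ≤ s ^ k * (A * u * (2 * (d / s)) ^ k) := by
            gcongr
            exact h'.trans (by gcongr)
        _ = A * 2 ^ k * (u ^ k * u * (d / u) ^ k) := by
            rw [mul_rpow zero_le_two (by positivity), div_rpow hd hs.le, div_rpow hd hu.le]
            field_simp
        _ ≤ _ := by gcongr; linarith
    have hk1 : 0 < k + 1 := by linarith
    calc s = (s ^ (k + 1)) ^ (1 / (k + 1)) := by
          rw [← rpow_mul hs.le, mul_one_div_cancel hk1.ne', rpow_one]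
      _ ≤ ((A * 2 ^ k) * (u ^ (k + 1) * (1 + d / u) ^ k)) ^ (1 / (k + 1)) := by gcongr
      _ = (A * 2 ^ k) ^ (1 / (k + 1)) * (u * (1 + d / u) ^ (k / (k + 1))) := by
          rw [mul_rpow (x := A * 2 ^ k) (by positivity) (by positivity),
            mul_rpow (x := u ^ (k + 1)) (by positivity) (by positivity), ← rpow_mul hu.le, ← rpow_mul (by positivity : (0 : ℝ) ≤ 1 + d / u),
            mul_one_div_cancel hk1.ne', rpow_one, mul_one_div]
      _ ≤ (A * 2 ^ k) ^ (1 : ℝ) * (u * (1 + d / u) ^ (k / (k + 1))) := by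
          gcongr
          rw [div_le_one hk1]; linarith
      _ = _ := by rw [rpow_one]; ring

/-- Comparison of critical radii for a family of ball functions with polynomial growth that is
bounded above (doubling) and below. -/
lemma sSup_admissible_comparison {X : Type*} [PseudoMetricSpace X] {F : X → ℝ → ℝ}
    {α β a C D : ℝ} (hα : 0 ≤ α) (hαβ : α < β) (ha : 0 ≤ a) (hC : 1 ≤ C) (hD : 1 ≤ D)
    (hmono : ∀ x y r R, r + dist x y ≤ R → F y r ≤ F x R)
    (hpos : ∀ x r, 0 < r → 0 < F x r)
    (hA : ∀ x r R, 0 < r → r ≤ R → F x r ≤ C * (r / R) ^ β * F x R)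
    (hB : ∀ x r R, 0 < r → r ≤ R → F x R ≤ D * (R / r) ^ a * F x r)
    {ρ : X → ℝ} (hρ : ∀ x, ρ x = sSup {r : ℝ | 0 < r ∧ F x r ≤ r ^ α}) :
    ∃ C > 0, ∃ k : ℝ, 1 ≤ k ∧ ∀ x y : X,
      C⁻¹ * ρ x * (1 + dist x y / ρ x) ^ (-k) ≤ ρ y ∧
      ρ y ≤ C * ρ x * (1 + dist x y / ρ x) ^ (k / (k + 1)) := by
  have hγ : 0 < β - α := sub_pos.2 hαβ
  have hbdd : ∀ x, BddAbove {r : ℝ | 0 < r ∧ F x r ≤ r ^ α} := fun x =>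
    bddAbove_admissible hαβ (hA x) hC (hpos x 1 one_pos)
  have hle : ∀ x K R, 1 ≤ K → 0 < R → F x R ≤ K * R ^ α →
      R * (C * K) ^ (-(1 / (β - α))) ≤ ρ x := fun x K R hK hR h => by
    rw [hρ]
    exact le_csSup (hbdd x) (growth_admissible hαβ hC hK (hA x) hR h)
  have hρ0 : ∀ x, 0 < ρ x := fun x => by
    refine lt_of_lt_of_le ?_ (hle x (max 1 (F x 1)) 1 (le_max_left _ _) one_pos (by simp))
    have : 0 < max 1 (F x 1) := lt_max_of_lt_left one_pos
    positivity
  set k : ℝ := max 1 (a / (β - α)) with hk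
  have hk1 : 1 ≤ k := le_max_left _ _
  have h4 : (1 : ℝ) ≤ 4 ^ a := one_le_rpow (by norm_num) ha
  have hCD : 1 ≤ C * (D * 4 ^ a) :=
    one_le_mul_of_one_le_of_one_le hC (one_le_mul_of_one_le_of_one_le hD h4)
  set A : ℝ := (C * (D * 4 ^ a)) ^ (1 / (β - α)) with hAdef
  have hA1 : 1 ≤ A := one_le_rpow hCD (by positivity)
  have lower : ∀ x y, A⁻¹ * ρ x * (1 + dist x y / ρ x) ^ (-k) ≤ ρ y := by
    intro x y
    have hx := hρ0 x
    set t : ℝ := 1 + dist x y / ρ x with ht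
    have ht1 : 1 ≤ t := by
      have : 0 ≤ dist x y / ρ x := by positivity
      linarith
    have ht0 : 0 < t := by linarith
    have hdt : ρ x * t = ρ x + dist x y := by rw [ht]; field_simp
    have hta : 1 ≤ t ^ a := one_le_rpow ht1 ha
    obtain ⟨r, ⟨hr0, hrF⟩, hr⟩ : ∃ r ∈ {r : ℝ | 0 < r ∧ F x r ≤ r ^ α}, ρ x / 2 < r := by
      refine exists_lt_of_lt_csSup ?_ (by rw [← hρ]; linarith)
      by_contra hne
      rw [Set.not_nonempty_iff_eq_empty] at hne
      have := hρ x
      rw [hne, Real.sSup_empty] at this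
      linarith
    have hrρ : r ≤ ρ x := by rw [hρ]; exact le_csSup (hbdd x) ⟨hr0, hrF⟩
    have hrt : r ≤ ρ x * t := by nlinarith
    have hFy : F y (ρ x * t) ≤ (D * 4 ^ a * t ^ a) * (ρ x * t) ^ α := by
      calc F y (ρ x * t) ≤ F x (2 * (ρ x * t)) := hmono _ _ _ _ (by linarith)
        _ ≤ D * (2 * (ρ x * t) / r) ^ a * F x r := hB _ _ _ hr0 (by linarith)
        _ ≤ D * (4 * t) ^ a * (ρ x * t) ^ α := by
          gcongr
          · exact (hpos x r hr0).le
          · rw [div_le_iff₀ hr0]; nlinarith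
          · exact hrF.trans (by gcongr)
        _ = _ := by rw [mul_rpow (by norm_num) ht0.le]; ring
    refine le_trans ?_ (hle y _ (ρ x * t) ?_ (by positivity) hFy)
    · have e1 : C * (D * 4 ^ a * t ^ a) = (C * (D * 4 ^ a)) * t ^ a := by ring
      rw [e1, mul_rpow (by positivity) (by positivity), ← rpow_mul ht0.le,
        rpow_neg (x := C * (D * 4 ^ a)) (by positivity), ← hAdef]
      have e2 : t ^ (-k) ≤ t ^ (a * -(1 / (β - α))) := by
        apply rpow_le_rpow_of_exponent_le ht1
        have : a / (β - α) ≤ k := le_max_right _ _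
        rw [mul_neg, mul_one_div]
        linarith
      have e3 : 0 < t ^ (a * -(1 / (β - α))) := rpow_pos_of_pos ht0 _
      calc A⁻¹ * ρ x * t ^ (-k) ≤ A⁻¹ * ρ x * (t * t ^ (a * -(1 / (β - α)))) := by
            gcongr; nlinarith
        _ = _ := by ring
    · exact one_le_mul_of_one_le_of_one_le (one_le_mul_of_one_le_of_one_le hD h4) hta
  have h2k : (1 : ℝ) ≤ 2 ^ k := one_le_rpow one_le_two (by linarith)
  refine ⟨A * 2 ^ k, by positivity, k, hk1, fun x y => ⟨le_trans ?_ (lower x y), ?_⟩⟩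
  · have := hρ0 x
    gcongr
    nlinarith
  · refine upper_of_lower hA1 hk1 (hρ0 y) (hρ0 x) dist_nonneg ?_
    rw [dist_comm]
    exact lower y x

lemma volume_ball_toReal (n : ℕ) (hn : n ≠ 0) (x : Rn n) {r : ℝ} (hr : 0 ≤ r) :
    (volume (ball x r)).toReal = r ^ n * (volume (ball (0 : Rn n) 1)).toReal := by
  have : Nontrivial (Rn n) := by
    have : Nonempty (Fin n) := ⟨⟨0, Nat.pos_of_ne_zero hn⟩⟩
    infer_instance
  rw [Measure.addHaar_ball volume x hr, ENNReal.toReal_mul,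
    ENNReal.toReal_ofReal (by positivity), finrank_euclideanSpace_fin]

lemma volume_ball_toReal_pos (n : ℕ) (x : Rn n) {r : ℝ} (hr : 0 < r) :
    0 < (volume (ball x r)).toReal :=
  ENNReal.toReal_pos (measure_ball_pos volume x hr).ne' measure_ball_lt_top.ne

lemma memLp_of_integrable_rpow {X : Type*} [MeasurableSpace X] {μ : Measure X} {V : X → ℝ} {q : ℝ}
    (hq : 0 < q) (hV : ∀ y, 0 ≤ V y) (h : Integrable (fun y => V y ^ q) μ) :
    MemLp V (ENNReal.ofReal q) μ := by
  have hm : AEStronglyMeasurable V μ := by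
    have h1 := (h.1.aemeasurable.pow_const (1 / q)).aestronglyMeasurable
    refine h1.congr (Filter.Eventually.of_forall fun y => ?_)
    simp only
    rw [← rpow_mul (hV y), mul_one_div_cancel hq.ne', rpow_one]
  rw [← integrable_norm_rpow_iff hm (by simpa using hq) ENNReal.ofReal_ne_top,
    ENNReal.toReal_ofReal hq.le]
  simpa only [norm_of_nonneg (hV _)] using h

/-- A reverse Hölder weight is absolutely continuous in a quantitative (`A_∞`) sense. -/
lemma IsReverseHolder.exists_setIntegral_le {n : ℕ} {V : Rn n → ℝ} {q : ℝ} (hq : 1 < q)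
    (hV : IsReverseHolder n V q) :
    ∃ C : ℝ, 1 ≤ C ∧ ∀ (x : Rn n) (R : ℝ) (E : Set (Rn n)), 0 < R → E ⊆ ball x R →
      ∫ y in E, V y ≤ C * ((volume E).toReal / (volume (ball x R)).toReal) ^ (1 - 1 / q) *
        ∫ y in ball x R, V y := by
  obtain ⟨h0, hVq, C, hC, hRH⟩ := hV
  have hq0 : 0 < q := by linarith
  refine ⟨max 1 C, le_max_left _ _, fun x R E hR hE => ?_⟩
  have hb := volume_ball_toReal_pos n x hR
  have hp : q.HolderConjugate (q / (q - 1)) := Real.HolderConjugate.conjExponent hq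
  have hp' : 1 / (q / (q - 1)) = 1 - 1 / q := by
    field_simp
  have hEfin : volume E ≠ ⊤ := ((measure_mono hE).trans_lt measure_ball_lt_top).ne
  have : IsFiniteMeasure (volume.restrict E) := ⟨by simpa using hEfin.lt_top⟩
  have h1 := integral_mul_le_Lp_mul_Lq_of_nonneg (μ := volume.restrict E) hp
    (f := V) (g := fun _ => 1) (Filter.Eventually.of_forall h0)
    (Filter.Eventually.of_forall fun _ => zero_le_one)
    (memLp_of_integrable_rpow hq0 h0 ((hVq x R hR).mono_set hE)) (memLp_const 1)
  simp only [mul_one, one_rpow, integral_const, smul_eq_mul, hp', measureReal_def,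
    Measure.restrict_apply_univ] at h1
  have h2 : ∫ y in E, V y ^ q ≤ ∫ y in ball x R, V y ^ q :=
    setIntegral_mono_set (hVq x R hR)
      (Filter.Eventually.of_forall fun y => rpow_nonneg (h0 y) q) (LE.le.eventuallyLE hE)
  have hEq : 0 ≤ ∫ y in E, V y ^ q := integral_nonneg fun y => rpow_nonneg (h0 y) q
  have hBq : 0 ≤ ∫ y in ball x R, V y ^ q := integral_nonneg fun y => rpow_nonneg (h0 y) q
  have hB : 0 ≤ ∫ y in ball x R, V y := integral_nonneg h0
  have h3 := hRH x R hR
  set b := (volume (ball x R)).toReal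
  set e := (volume E).toReal
  have he : 0 ≤ e := ENNReal.toReal_nonneg
  rw [mul_rpow (by positivity) hBq, inv_rpow hb.le] at h3
  have hbq : 0 < b ^ (1 / q) := rpow_pos_of_pos hb _
  calc ∫ y in E, V y ≤ (∫ y in E, V y ^ q) ^ (1 / q) * e ^ (1 - 1 / q) := h1
    _ ≤ (∫ y in ball x R, V y ^ q) ^ (1 / q) * e ^ (1 - 1 / q) := by gcongr
    _ = b ^ (1 / q) * ((b ^ (1 / q))⁻¹ * (∫ y in ball x R, V y ^ q) ^ (1 / q)) *
          e ^ (1 - 1 / q) := by field_simp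
    _ ≤ b ^ (1 / q) * (C * b⁻¹ * ∫ y in ball x R, V y) * e ^ (1 - 1 / q) := by gcongr
    _ = C * (e / b) ^ (1 - 1 / q) * ∫ y in ball x R, V y := by
      rw [div_rpow he hb.le, rpow_sub hb, rpow_one]
      field_simp
    _ ≤ _ := by gcongr; exact le_max_right _ _

lemma IsReverseHolder.integrableOn_ball {n : ℕ} {V : Rn n → ℝ} {q : ℝ} (hq : 1 < q)
    (hV : IsReverseHolder n V q) (x : Rn n) (r : ℝ) : IntegrableOn V (ball x r) := by
  rcases le_or_gt r 0 with hr | hr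
  · simp [ball_eq_empty.2 hr]
  · have : IsFiniteMeasure (volume.restrict (ball x r)) :=
      ⟨by simpa using measure_ball_lt_top⟩
    exact (memLp_of_integrable_rpow (by linarith) hV.1 (hV.2.1 x r hr)).integrable
      (by simpa using hq.le)

lemma IsReverseHolder.setIntegral_ball_mono {n : ℕ} {V : Rn n → ℝ} {q : ℝ} (hq : 1 < q)
    (hV : IsReverseHolder n V q) (x y : Rn n) (r R : ℝ) (h : r + dist x y ≤ R) :
    ∫ z in ball y r, V z ≤ ∫ z in ball x R, V z :=
  setIntegral_mono_set (hV.integrableOn_ball hq x R) (Filter.Eventually.of_forall hV.1)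
    (LE.le.eventuallyLE (ball_subset_ball' (by rwa [dist_comm])))

/-- Growth of `∫_{B(x,r)} V` from below. -/
lemma IsReverseHolder.exists_setIntegral_ball_le {n : ℕ} (hn : n ≠ 0) {V : Rn n → ℝ} {q : ℝ}
    (hq : 1 < q) (hV : IsReverseHolder n V q) :
    ∃ C : ℝ, 1 ≤ C ∧ ∀ (x : Rn n) (r R : ℝ), 0 < r → r ≤ R →
      ∫ y in ball x r, V y ≤ C * (r / R) ^ ((n : ℝ) * (1 - 1 / q)) * ∫ y in ball x R, V y := by
  obtain ⟨C, hC, h⟩ := hV.exists_setIntegral_le hq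
  refine ⟨C, hC, fun x r R hr hrR => ?_⟩
  have hR : 0 < R := hr.trans_le hrR
  have h1 := h x R (ball x r) hR (ball_subset_ball hrR)
  rwa [volume_ball_toReal n hn x hr.le, volume_ball_toReal n hn x hR.le,
    mul_div_mul_right _ _ (volume_ball_toReal_pos n 0 one_pos).ne', ← div_pow, ← rpow_natCast,
    ← rpow_mul (by positivity)] at h1

/-- A reverse Hölder weight is doubling, in iterated form. -/
lemma IsReverseHolder.exists_setIntegral_ball_doubling {n : ℕ} (hn : n ≠ 0) {V : Rn n → ℝ} {q : ℝ}
    (hq : 1 < q) (hV : IsReverseHolder n V q) :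
    ∃ a : ℝ, 0 ≤ a ∧ ∀ (x : Rn n) (r R : ℝ), 0 < r → r ≤ R →
      ∫ y in ball x R, V y ≤ 2 * (R / r) ^ a * ∫ y in ball x r, V y := by
  obtain ⟨C, hC, h⟩ := hV.exists_setIntegral_le hq
  have hε : 0 < 1 - 1 / q := by
    rw [sub_pos, div_lt_one (by linarith)]; exact hq
  obtain ⟨θ, ⟨hθ0, hθ1⟩, hθ⟩ : ∃ θ : ℝ, (0 < θ ∧ θ < 1) ∧ C * (1 - θ ^ n) ^ (1 - 1 / q) < 1 / 2 := by
    have hc : ContinuousAt (fun θ : ℝ => C * (1 - θ ^ n) ^ (1 - 1 / q)) 1 := by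
      refine continuousAt_const.mul (ContinuousAt.rpow_const (by fun_prop) (Or.inr hε.le))
    have h1 : ∀ᶠ θ in nhdsWithin (1 : ℝ) (Set.Iio 1), C * (1 - θ ^ n) ^ (1 - 1 / q) < 1 / 2 :=
      (hc.eventually_lt_const (by simp only [one_pow, sub_self, zero_rpow hε.ne']; norm_num)).filter_mono nhdsWithin_le_nhds
    have h2 : ∀ᶠ θ in nhdsWithin (1 : ℝ) (Set.Iio 1), 0 < θ ∧ θ < 1 :=
      Ioo_mem_nhdsLT one_pos
    exact (h2.and h1).exists
  have hstep : ∀ (x : Rn n) (R : ℝ), 0 < R →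
      ∫ y in ball x R, V y ≤ 2 * ∫ y in ball x (θ * R), V y := by
    intro x R hR
    have hsub : ball x (θ * R) ⊆ ball x R := ball_subset_ball (by nlinarith)
    have h1 := h x R (ball x R \ ball x (θ * R)) hR Set.sdiff_subset
    rw [setIntegral_sdiff measurableSet_ball (hV.integrableOn_ball hq x R) hsub,
      measure_sdiff hsub measurableSet_ball.nullMeasurableSet measure_ball_lt_top.ne,
      ENNReal.toReal_sub_of_le (measure_mono hsub) measure_ball_lt_top.ne,
      volume_ball_toReal n hn x hR.le, volume_ball_toReal n hn x (by positivity),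
      ← sub_mul, mul_div_mul_right _ _ (volume_ball_toReal_pos n 0 one_pos).ne', sub_div,
      div_self (by positivity), mul_pow, mul_div_cancel_right₀ _ (by positivity)] at h1
    have hB : 0 ≤ ∫ y in ball x R, V y := integral_nonneg hV.1
    nlinarith
  have hiter : ∀ (x : Rn n) (R : ℝ), 0 < R → ∀ m : ℕ,
      ∫ y in ball x R, V y ≤ 2 ^ m * ∫ y in ball x (θ ^ m * R), V y := by
    intro x R hR m
    induction m with
    | zero => simp
    | succ m ih =>
      have := hstep x (θ ^ m * R) (by positivity)
      calc _ ≤ _ := ih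
        _ ≤ 2 ^ m * (2 * ∫ y in ball x (θ * (θ ^ m * R)), V y) := by gcongr
        _ = _ := by rw [← mul_assoc, ← mul_assoc, ← pow_succ, ← pow_succ']
  have hlog : Real.log θ < 0 := Real.log_neg hθ0 hθ1
  have ha : 0 ≤ -(Real.log 2 / Real.log θ) := by
    rw [← div_neg]
    exact div_nonneg (Real.log_nonneg one_le_two) (by linarith)
  have hθa : θ ^ (Real.log 2 / Real.log θ) = 2 := by
    rw [rpow_def_of_pos hθ0, mul_div_cancel₀ _ hlog.ne, Real.exp_log two_pos]
  refine ⟨_, ha, fun x r R hr hrR => ?_⟩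
  have hR : 0 < R := hr.trans_le hrR
  obtain ⟨m, hm1, hm2⟩ := exists_nat_pow_near_of_lt_one (div_pos hr hR)
    ((div_le_one hR).2 hrR) hθ0 hθ1
  have h2 : (2 : ℝ) ^ m ≤ (R / r) ^ (-(Real.log 2 / Real.log θ)) := by
    rw [rpow_neg (by positivity), ← inv_rpow (by positivity), inv_div]
    calc (2 : ℝ) ^ m = (θ ^ m) ^ (Real.log 2 / Real.log θ) := by
          rw [← rpow_natCast θ, ← rpow_mul hθ0.le, mul_comm, rpow_mul hθ0.le, hθa, rpow_natCast]
      _ ≤ _ := rpow_le_rpow_of_nonpos (by positivity) hm2 (by linarith)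
  have hB : 0 ≤ ∫ y in ball x r, V y := integral_nonneg hV.1
  calc ∫ y in ball x R, V y ≤ 2 ^ (m + 1) * ∫ y in ball x (θ ^ (m + 1) * R), V y :=
        hiter x R hR _
    _ ≤ 2 ^ (m + 1) * ∫ y in ball x r, V y := by
        refine mul_le_mul_of_nonneg_left (hV.setIntegral_ball_mono hq _ _ _ _ ?_) (by positivity)
        rw [dist_self, add_zero]
        exact ((lt_div_iff₀ hR).1 hm1).le
    _ ≤ _ := by
        rw [pow_succ']
        gcongr

lemma IsReverseHolder.setIntegral_ball_pos {n : ℕ} (hn : n ≠ 0) {V : Rn n → ℝ} {q : ℝ}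
    (hq : 1 < q) (hV : IsReverseHolder n V q)
    (hV0 : ¬ V =ᵐ[(volume : Measure (Rn n))] 0) (x : Rn n) (r : ℝ) (hr : 0 < r) :
    0 < ∫ y in ball x r, V y := by
  by_contra hle
  have h0 : ∫ y in ball x r, V y = 0 := le_antisymm (not_lt.1 hle) (integral_nonneg hV.1)
  obtain ⟨a, -, hD⟩ := hV.exists_setIntegral_ball_doubling hn hq
  have hzero : ∀ k : ℕ, V =ᵐ[volume.restrict (ball x k)] 0 := by
    intro k
    rw [← setIntegral_eq_zero_iff_of_nonneg_ae (Filter.Eventually.of_forall hV.1)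
      (hV.integrableOn_ball hq x k)]
    refine le_antisymm ?_ (integral_nonneg hV.1)
    have h1 := hD x r (max r k) hr (le_max_left _ _)
    rw [h0, mul_zero] at h1
    exact (hV.setIntegral_ball_mono hq x x k (max r k) (by simp)).trans h1
  apply hV0
  rw [← Measure.restrict_univ (μ := volume), ← iUnion_ball_nat x]
  exact (ae_restrict_iUnion_iff _ _).2 hzero

/-- For `n ≥ 3` and nonnegative `V ∈ B_q`, `q > n/2`, not a.e. zero, the critical radius
function satisfies the two-sided comparison
`C⁻¹ ρ(x) (1+|x-y|/ρ(x))^{-k₀} ≤ ρ(y) ≤ C ρ(x) (1+|x-y|/ρ(x))^{k₀/(k₀+1)}`. -/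
theorem critRho_comparison (n : ℕ) (hn : 3 ≤ n) (V : Rn n → ℝ) (q : ℝ)
    (hq : (n : ℝ) / 2 < q) (hV : IsReverseHolder n V q)
    (hV0 : ¬ V =ᵐ[(volume : Measure (Rn n))] 0) :
    ∃ C > 0, ∃ k₀ : ℝ, 1 ≤ k₀ ∧ ∀ x y : Rn n,
      C⁻¹ * critRho n V x * (1 + dist x y / critRho n V x) ^ (-k₀) ≤ critRho n V y ∧
      critRho n V y ≤
        C * critRho n V x * (1 + dist x y / critRho n V x) ^ (k₀ / (k₀ + 1)) := by
  have hn0 : n ≠ 0 := by omega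
  have hn3 : (3 : ℝ) ≤ n := by exact_mod_cast hn
  have hq1 : 1 < q := by linarith
  obtain ⟨C, hC, hA⟩ := hV.exists_setIntegral_ball_le hn0 hq1
  obtain ⟨a, ha, hB⟩ := hV.exists_setIntegral_ball_doubling hn0 hq1
  refine sSup_admissible_comparison (F := fun x r => ∫ y in ball x r, V y) (α := (n : ℝ) - 2)
    (β := (n : ℝ) * (1 - 1 / q)) (by linarith) ?_ ha hC one_le_two
    (hV.setIntegral_ball_mono hq1) (hV.setIntegral_ball_pos hn0 hq1 hV0) hA hB fun x => ?_
  · have : (n : ℝ) / q < 2 := by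
      rw [div_lt_iff₀ (by linarith)]
      linarith
    rw [mul_sub, mul_one_div]
    linarith
  · rw [critRho, critSet]
    congr 1
    ext r
    refine and_congr_right fun hr => ?_
    rw [show (2 : ℝ) - n = -((n : ℝ) - 2) by ring, rpow_neg hr.le,
      inv_mul_le_iff₀ (rpow_pos_of_pos hr _), mul_one]
end
end

section
/- Let n ≥ 3 and let V ∈ B_q for some q ≥ n/2 be nonnegative and not almost everywhere zero, with critical radius function ρ. For every p ∈ [1, ∞) there exists a constant C = C(p, n, V) > 0 such that for every f ∈ BMO_L(ℝⁿ) and every cube Q ⊂ ℝⁿ with center x_Q and sidelength ℓ(Q) ≥ ρ(x_Q), ( (1/|Q|) ∫_Q |f(x)|^p dx )^{1/p} ≤ C ‖f‖_{BMO_L}. -/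
open MeasureTheory Metric Real

noncomputable section

/-- The average of `f` over the cube with center `x` and sidelength `l`
(whose Lebesgue measure is `l^n`). -/
def cubeAvg (n : ℕ) (f : Rn n → ℝ) (x : Rn n) (l : ℝ) : ℝ :=
  (1 / l ^ n) * ∫ y in cube n x l, f y

/-- `f` satisfies the `BMO_L` bounds with constant `N`: mean oscillation at most `N` on
every cube, and average of `|f|` at most `N` on every cube whose sidelength is at least
the critical radius of its center. -/
def IsBMOLBound (n : ℕ) (V : Rn n → ℝ) (f : Rn n → ℝ) (N : ℝ) : Prop :=
  (∀ (x : Rn n) (l : ℝ), 0 < l →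
    (1 / l ^ n) * (∫ y in cube n x l, |f y - cubeAvg n f x l|) ≤ N) ∧
  (∀ (x : Rn n) (l : ℝ), 0 < l → critRho n V x ≤ l →
    (1 / l ^ n) * (∫ y in cube n x l, |f y|) ≤ N)

section JohnNirenberg

open Filter Topology Set
open scoped ENNReal

variable {ι : Type*} [Fintype ι] {f : (ι → ℝ) → ℝ}

/-- If the mean of `|f - a|` over a ball is at most `T`, the mean of `f` is within `T` of `a`. -/
lemma abs_setAverage_sub_le (hf : LocallyIntegrable f volume) {a T : ℝ} (hT : 0 ≤ T)
    {x : ι → ℝ} {r : ℝ} (hr : 0 < r)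
    (h : ∫⁻ y in closedBall x r, ‖f y - a‖ₑ ≤ ENNReal.ofReal (T * (2 * r) ^ Fintype.card ι)) :
    |(⨍ y in closedBall x r, f y) - a| ≤ T := by
  have hfi : IntegrableOn f (closedBall x r) := hf.integrableOn_isCompact (isCompact_closedBall x r)
  have hpos : 0 < (2 * r) ^ Fintype.card ι := by positivity
  have hvol : volume.real (closedBall x r) = (2 * r) ^ Fintype.card ι := by
    rw [measureReal_def, Real.volume_pi_closedBall x hr.le, ENNReal.toReal_ofReal hpos.le]
  have hci : IntegrableOn (fun _ : ι → ℝ => a) (closedBall x r) :=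
    integrableOn_const (measure_closedBall_lt_top).ne
  have hint : ‖∫ y in closedBall x r, (f y - a)‖ₑ ≤
      ENNReal.ofReal (T * (2 * r) ^ Fintype.card ι) :=
    (enorm_integral_le_lintegral_enorm _).trans h
  rw [Real.enorm_eq_ofReal_abs, ENNReal.ofReal_le_ofReal_iff (by positivity),
    integral_sub hfi hci, setIntegral_const, hvol, smul_eq_mul] at hint
  rw [setAverage_eq, hvol, smul_eq_mul]
  have : ((2 * r) ^ Fintype.card ι)⁻¹ * (∫ y in closedBall x r, f y) - a =
      ((2 * r) ^ Fintype.card ι)⁻¹ *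
        ((∫ y in closedBall x r, f y) - (2 * r) ^ Fintype.card ι * a) := by
    field_simp
  rw [this, abs_mul, abs_of_pos (inv_pos.2 hpos), inv_mul_le_iff₀ hpos]
  linarith

/-- A form of the Lebesgue differentiation theorem along dyadic radii. -/
lemma ae_abs_sub_le_of_lintegral_le (hf : LocallyIntegrable f volume) {a T : ℝ} (hT : 0 ≤ T)
    {R : ℝ} (hR : 0 < R) :
    ∀ᵐ y, (∀ j : ℕ, ∫⁻ z in closedBall y (R / 2 ^ j), ‖f z - a‖ₑ ≤
      ENNReal.ofReal (T * (2 * (R / 2 ^ j)) ^ Fintype.card ι)) → |f y - a| ≤ T := by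
  filter_upwards [IsUnifLocDoublingMeasure.ae_tendsto_average
    (volume : Measure (ι → ℝ)) hf 1] with y hy hj
  have hδ : Tendsto (fun j : ℕ => R / 2 ^ j) atTop (𝓝[>] 0) := by
    refine tendsto_nhdsWithin_iff.2 ⟨?_, Eventually.of_forall fun j => ?_⟩
    · have := (tendsto_pow_atTop_nhds_zero_of_lt_one (r := (1 / 2 : ℝ)) (by norm_num)
        (by norm_num)).const_mul R
      simpa [div_eq_mul_inv] using this
    · exact mem_Ioi.2 (by positivity)
  have hlim := hy (fun _ : ℕ => y) _ hδ
    (Eventually.of_forall fun j => mem_closedBall_self (by positivity))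
  exact le_of_tendsto (hlim.sub_const a).abs
    (Eventually.of_forall fun j => abs_setAverage_sub_le hf hT (by positivity) (hj j))

/-- The stopping radius: the first dyadic radius at which the mean of `|f - a|` exceeds `T`. -/
lemma exists_stopping_radius {a T R : ℝ} {x y : ι → ℝ} (hR : 0 < R)
    (hy : y ∈ closedBall x R)
    (hbig : ∫⁻ z in closedBall x (2 * R), ‖f z - a‖ₑ ≤
      ENNReal.ofReal (T * (R / 2) ^ Fintype.card ι)) (hT : 0 ≤ T)
    (hex : ∃ j : ℕ, ¬ ∫⁻ z in closedBall y (R / 2 ^ j), ‖f z - a‖ₑ ≤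
      ENNReal.ofReal (T * (2 * (R / 2 ^ j)) ^ Fintype.card ι)) :
    ∃ r, 0 < r ∧ 8 * r ≤ R ∧
      ENNReal.ofReal (T * (2 * r) ^ Fintype.card ι) ≤ ∫⁻ z in closedBall y r, ‖f z - a‖ₑ ∧
      ∫⁻ z in closedBall y (8 * r), ‖f z - a‖ₑ ≤
        ENNReal.ofReal (T * (2 * (8 * r)) ^ Fintype.card ι) := by
  classical
  set m := Nat.find hex with hm
  have hm1 := Nat.find_spec hex
  rw [← hm] at hm1
  have h3 : 3 ≤ m := by
    by_contra! hlt
    apply hm1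
    have h2 : (2 : ℝ) ^ m ≤ 2 ^ 2 := pow_le_pow_right₀ (by norm_num) (by omega)
    have hsub : closedBall y (R / 2 ^ m) ⊆ closedBall x (2 * R) := by
      refine closedBall_subset_closedBall' ?_
      have : R / 2 ^ m ≤ R := div_le_self hR.le (one_le_pow₀ (by norm_num))
      have := mem_closedBall.1 hy
      linarith
    refine (lintegral_mono_set hsub).trans (hbig.trans ?_)
    gcongr
    rw [← mul_div_assoc, div_le_div_iff₀ (by norm_num) (by positivity)]
    nlinarith
  obtain ⟨j, hj⟩ : ∃ j, m = j + 3 := ⟨m - 3, by omega⟩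
  have h8 : 8 * (R / 2 ^ m) = R / 2 ^ j := by
    rw [hj, pow_add]; field_simp; norm_num
  refine ⟨R / 2 ^ m, by positivity, ?_, (not_le.1 hm1).le, ?_⟩
  · rw [h8]
    exact div_le_self hR.le (one_le_pow₀ (by norm_num))
  · rw [h8]
    exact not_not.1 (Nat.find_min hex (m := j) (by omega))

/-- **John–Nirenberg inequality** on `ℝⁿ`: exponential decay of the distribution function. -/
theorem john_nirenberg (hf : LocallyIntegrable f volume) {N : ℝ} (hN : 0 < N)
    (H : ∀ (x : ι → ℝ) (r : ℝ), 0 < r →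
      ∫⁻ y in closedBall x r, ‖f y - ⨍ z in closedBall x r, f z‖ₑ ≤
        ENNReal.ofReal (N * (2 * r) ^ Fintype.card ι)) (k : ℕ) :
    ∀ (x : ι → ℝ) (R : ℝ), 0 < R →
      volume {y ∈ closedBall x R |
        k * (2 * 8 ^ Fintype.card ι * N) < |f y - ⨍ z in closedBall x (2 * R), f z|} ≤
      ENNReal.ofReal ((1 / 2) ^ k * (2 * R) ^ Fintype.card ι) := by
  set d := Fintype.card ι
  set T : ℝ := 2 * 8 ^ d * N with hTdef
  have hT : 0 < T := by positivity
  induction k with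
  | zero =>
    intro x R hR
    refine (measure_mono (sep_subset _ _)).trans ?_
    simp [Real.volume_pi_closedBall x hR.le, d]
  | succ k ih =>
    intro x R hR
    set a := ⨍ z in closedBall x (2 * R), f z with ha
    set E := {y ∈ closedBall x R | ((k + 1 : ℕ) : ℝ) * T < |f y - a|} with hE
    set G := {y : ι → ℝ | (∀ j : ℕ, ∫⁻ z in closedBall y (R / 2 ^ j), ‖f z - a‖ₑ ≤
      ENNReal.ofReal (T * (2 * (R / 2 ^ j)) ^ d)) → |f y - a| ≤ T} with hG
    have hGae : volume Gᶜ = 0 := ae_abs_sub_le_of_lintegral_le hf hT.le hR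
    have hbig : ∫⁻ z in closedBall x (2 * R), ‖f z - a‖ₑ ≤
        ENNReal.ofReal (N * (2 * (2 * R)) ^ d) := H x (2 * R) (by positivity)
    have hrad : ∀ y ∈ E ∩ G, ∃ r, 0 < r ∧ 8 * r ≤ R ∧
        ENNReal.ofReal (T * (2 * r) ^ d) ≤ ∫⁻ z in closedBall y r, ‖f z - a‖ₑ ∧
        ∫⁻ z in closedBall y (8 * r), ‖f z - a‖ₑ ≤
          ENNReal.ofReal (T * (2 * (8 * r)) ^ d) := by
      rintro y ⟨⟨hyB, hyk⟩, hyG⟩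
      refine exists_stopping_radius hR hyB (hbig.trans (ENNReal.ofReal_le_ofReal ?_)) hT.le ?_
      · have : (2 * (2 * R)) ^ d = 8 ^ d * (R / 2) ^ d := by rw [← mul_pow]; congr 1; ring
        rw [this, hTdef]
        have : 0 ≤ N * (8 ^ d * (R / 2) ^ d) := by positivity
        change _ ≤ 2 * 8 ^ d * N * (R / 2) ^ d
        nlinarith
      · by_contra! hcon
        have h1 := hyG hcon
        push_cast at hyk
        have : 0 ≤ (k : ℝ) * T := by positivity
        linarith
    choose! r hr0 hr8 hrlow hrhigh using hrad
    obtain ⟨u, huE, hdisj, hcov⟩ := Vitali.exists_disjoint_subfamily_covering_enlargement_closedBall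
      (E ∩ G) id r R (fun y hy => by linarith [hr0 y hy, hr8 y hy]) 4 (by norm_num)
    have hucount : u.Countable := by
      refine hdisj.countable_of_nonempty_interior fun y hy => ?_
      exact (nonempty_ball.2 (hr0 y (huE hy))).mono ball_subset_interior_closedBall
    have hEsub : E ∩ G ⊆ ⋃ b ∈ u, {y ∈ closedBall b (4 * r b) |
        k * T < |f y - ⨍ z in closedBall b (2 * (4 * r b)), f z|} := by
      intro y hy
      obtain ⟨b, hb, hyb⟩ := hcov y hy
      refine mem_iUnion₂.2 ⟨b, hb, hyb (mem_closedBall_self (hr0 y hy).le), ?_⟩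
      have hb8 : 2 * (4 * r b) = 8 * r b := by ring
      have h1 := abs_setAverage_sub_le hf hT.le (mul_pos (by norm_num) (hr0 b (huE hb)))
        (hrhigh b (huE hb))
      have h2 := hy.1.2
      rw [hb8]
      push_cast at h2
      have h3 := abs_sub_le (f y) (⨍ z in closedBall b (8 * r b), f z) a
      linarith
    have hsum : ∑' b : u, ENNReal.ofReal (T * (2 * r b) ^ d) ≤
        ENNReal.ofReal (N * (2 * (2 * R)) ^ d) := by
      calc ∑' b : u, ENNReal.ofReal (T * (2 * r b) ^ d)
          ≤ ∑' b : u, ∫⁻ z in closedBall (b : ι → ℝ) (r b), ‖f z - a‖ₑ :=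
            ENNReal.tsum_le_tsum fun b => hrlow b (huE b.2)
        _ = ∫⁻ z in ⋃ b ∈ u, closedBall b (r b), ‖f z - a‖ₑ :=
            (lintegral_biUnion hucount (fun _ _ => measurableSet_closedBall) hdisj _).symm
        _ ≤ ∫⁻ z in closedBall x (2 * R), ‖f z - a‖ₑ := by
            refine lintegral_mono_set (iUnion₂_subset fun b hb => ?_)
            refine closedBall_subset_closedBall' ?_
            have := mem_closedBall.1 (huE hb).1.1
            linarith [hr0 b (huE hb), hr8 b (huE hb)]
        _ ≤ _ := hbig
    set c : ℝ := (1 / 2) ^ k * 4 ^ d / T with hc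
    have hc0 : 0 ≤ c := by positivity
    calc volume E ≤ volume (E ∩ G) + volume Gᶜ := by
          refine (measure_mono fun y hy => ?_).trans (measure_union_le _ _)
          by_cases hyG : y ∈ G
          exacts [Or.inl ⟨hy, hyG⟩, Or.inr hyG]
      _ = volume (E ∩ G) := by rw [hGae, add_zero]
      _ ≤ ∑' b : u, volume {y ∈ closedBall (b : ι → ℝ) (4 * r b) |
            k * T < |f y - ⨍ z in closedBall (b : ι → ℝ) (2 * (4 * r b)), f z|} :=
          (measure_mono hEsub).trans (measure_biUnion_le _ hucount _)
      _ ≤ ∑' b : u, ENNReal.ofReal c * ENNReal.ofReal (T * (2 * r b) ^ d) := by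
          refine ENNReal.tsum_le_tsum fun b => ?_
          refine (ih b (4 * r b) (mul_pos (by norm_num) (hr0 b (huE b.2)))).trans_eq ?_
          rw [← ENNReal.ofReal_mul hc0]
          congr 1
          rw [show 2 * (4 * r b) = 4 * (2 * r b) by ring, mul_pow, hc]
          field_simp
      _ ≤ ENNReal.ofReal c * ENNReal.ofReal (N * (2 * (2 * R)) ^ d) := by
          rw [ENNReal.tsum_mul_left]
          gcongr
      _ = ENNReal.ofReal ((1 / 2) ^ (k + 1) * (2 * R) ^ d) := by
          rw [← ENNReal.ofReal_mul hc0]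
          congr 1
          rw [hc, hTdef, mul_pow 2 (2 * R), show (8 : ℝ) = 4 * 2 by norm_num, mul_pow 4 2 d, pow_succ]
          field_simp

end JohnNirenberg

/-- The constant bounding the `p`-th moment of a function with geometrically decaying tails. -/
def geomMoment (p : ℝ) : ℝ := 1 + ∑' k : ℕ, ((k : ℝ) + 2) ^ ⌈p⌉₊ * (1 / 2) ^ k

lemma summable_geomMoment (m : ℕ) :
    Summable fun k : ℕ => ((k : ℝ) + 2) ^ m * (1 / 2 : ℝ) ^ k := by
  have h := (summable_nat_add_iff 2).2
    (summable_pow_mul_geometric_of_norm_lt_one (R := ℝ) m (r := 1 / 2) (by norm_num))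
  refine (h.mul_left 4).congr fun k => ?_
  push_cast
  rw [pow_add]
  ring

/-- A function whose distribution function decays geometrically has finite moments. -/
lemma lintegral_rpow_le_of_geometric_tail {α : Type*} [MeasurableSpace α] {μ : Measure α}
    {g : α → ℝ} (hg : AEStronglyMeasurable g μ) {p : ℝ} (hp : 1 ≤ p) {M v : ℝ} (hM : 0 < M)
    (hv : 0 ≤ v) (huniv : μ Set.univ ≤ ENNReal.ofReal v)
    (htail : ∀ k : ℕ, μ {y | (k + 1) * M < |g y|} ≤ ENNReal.ofReal ((1 / 2) ^ k * v)) :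
    ∫⁻ y, ENNReal.ofReal (|g y| ^ p) ∂μ ≤ ENNReal.ofReal (M ^ p * geomMoment p * v) := by
  set m := ⌈p⌉₊ with hm
  have hp0 : 0 ≤ p := by linarith
  set S : ℕ → Set α := fun k => {y | (k + 1) * M < |g y|} with hS
  have hSm : ∀ k, NullMeasurableSet (S k) μ := fun k =>
    aestronglyMeasurable_const.nullMeasurableSet_lt hg.norm
  set w : ℕ → ℝ := fun k => M ^ p * ((k : ℝ) + 2) ^ m with hw
  have hw0 : ∀ k, 0 ≤ w k := fun k => by positivity
  have hpt : ∀ y, ENNReal.ofReal (|g y| ^ p) ≤ ENNReal.ofReal (M ^ p) +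
      ∑' k, (S k).indicator (fun _ => ENNReal.ofReal (w k)) y := by
    intro y
    by_cases hy : |g y| ≤ M
    · exact (ENNReal.ofReal_le_ofReal (Real.rpow_le_rpow (abs_nonneg _) hy hp0)).trans le_self_add
    · push Not at hy
      have h1 : 1 < |g y| / M := (one_lt_div hM).2 hy
      have hceil : 1 < ⌈|g y| / M⌉₊ := Nat.lt_ceil.2 (by simpa using h1)
      obtain ⟨k, hk⟩ : ∃ k, ⌈|g y| / M⌉₊ = k + 2 := ⟨⌈|g y| / M⌉₊ - 2, by omega⟩
      have hmem : y ∈ S k := by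
        have := (Nat.lt_ceil (a := |g y| / M) (n := k + 1)).1 (by omega)
        rw [lt_div_iff₀ hM] at this
        simpa [hS] using this
      have hle : |g y| ≤ M * (k + 2) := by
        have := Nat.le_ceil (|g y| / M)
        rw [hk, div_le_iff₀ hM] at this
        push_cast at this
        linarith
      have hb : |g y| ^ p ≤ w k := by
        refine (Real.rpow_le_rpow (abs_nonneg _) hle hp0).trans ?_
        rw [Real.mul_rpow hM.le (by positivity), hw]
        refine mul_le_mul_of_nonneg_left ?_ (by positivity)
        rw [← Real.rpow_natCast]
        exact Real.rpow_le_rpow_of_exponent_le (by linarith [k.cast_nonneg (α := ℝ)])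
          (Nat.le_ceil p)
      calc ENNReal.ofReal (|g y| ^ p) ≤ (S k).indicator (fun _ => ENNReal.ofReal (w k)) y := by
            rw [Set.indicator_of_mem hmem]; exact ENNReal.ofReal_le_ofReal hb
        _ ≤ ∑' k, (S k).indicator (fun _ => ENNReal.ofReal (w k)) y := ENNReal.le_tsum k
        _ ≤ _ := le_add_self
  have hsum := summable_geomMoment m
  calc ∫⁻ y, ENNReal.ofReal (|g y| ^ p) ∂μ
      ≤ ∫⁻ y, (ENNReal.ofReal (M ^ p) +
          ∑' k, (S k).indicator (fun _ => ENNReal.ofReal (w k)) y) ∂μ := lintegral_mono hpt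
    _ = ENNReal.ofReal (M ^ p) * μ Set.univ + ∑' k, ENNReal.ofReal (w k) * μ (S k) := by
        rw [lintegral_add_left measurable_const, lintegral_const,
          lintegral_tsum fun k => aemeasurable_const.indicator₀ (hSm k)]
        simp_rw [lintegral_indicator_const₀ (hSm _)]
    _ ≤ ENNReal.ofReal (M ^ p) * ENNReal.ofReal v +
          ∑' k : ℕ, ENNReal.ofReal (w k) * ENNReal.ofReal ((1 / 2) ^ k * v) := by
        gcongr with k
        exact htail k
    _ = ENNReal.ofReal (M ^ p * v) +
          ∑' k : ℕ, ENNReal.ofReal (M ^ p * v * (((k : ℝ) + 2) ^ m * (1 / 2) ^ k)) := by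
        rw [ENNReal.ofReal_mul (by positivity)]
        congr 2 with k
        rw [← ENNReal.ofReal_mul (hw0 k), hw]
        congr 1
        ring
    _ = ENNReal.ofReal (M ^ p * geomMoment p * v) := by
        rw [← ENNReal.ofReal_tsum_of_nonneg (fun k => by positivity) (hsum.mul_left _),
          ← ENNReal.ofReal_add (by positivity) (tsum_nonneg fun k => by positivity),
          tsum_mul_left, geomMoment]
        congr 1
        ring

lemma geomMoment_pos (p : ℝ) : 0 < geomMoment p :=
  add_pos_of_pos_of_nonneg one_pos (tsum_nonneg fun k => by positivity)

/-- John–Nirenberg in `L^p` form, on a ball whose double has mean at most `N`. -/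
lemma lintegral_rpow_closedBall_le {ι : Type*} [Fintype ι] {f : (ι → ℝ) → ℝ}
    (hf : LocallyIntegrable f volume) {N : ℝ} (hN : 0 < N)
    (H : ∀ (x : ι → ℝ) (r : ℝ), 0 < r →
      ∫⁻ y in closedBall x r, ‖f y - ⨍ z in closedBall x r, f z‖ₑ ≤
        ENNReal.ofReal (N * (2 * r) ^ Fintype.card ι))
    {p : ℝ} (hp : 1 ≤ p) {x : ι → ℝ} {r : ℝ} (hr : 0 < r)
    (ha : |⨍ z in closedBall x (2 * r), f z| ≤ N) :
    ∫⁻ y in closedBall x r, ENNReal.ofReal (|f y| ^ p) ≤ ENNReal.ofReal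
      ((2 * 8 ^ Fintype.card ι * N) ^ p * geomMoment p * (2 * r) ^ Fintype.card ι) := by
  set M := 2 * 8 ^ Fintype.card ι * N with hM
  have hNM : N ≤ M := by
    have : (1 : ℝ) ≤ 8 ^ Fintype.card ι := one_le_pow₀ (by norm_num)
    nlinarith
  refine lintegral_rpow_le_of_geometric_tail hf.aestronglyMeasurable.restrict hp
    (by positivity) (by positivity) ?_ fun k => ?_
  · rw [Measure.restrict_apply_univ, Real.volume_pi_closedBall x hr.le]
  · rw [Measure.restrict_apply' measurableSet_closedBall]
    refine (measure_mono ?_).trans (john_nirenberg hf hN H k x r hr)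
    rintro y ⟨hy, hyB⟩
    refine ⟨hyB, ?_⟩
    have h1 : (k + 1) * M < |f y| := hy
    have h2 := abs_sub_abs_le_abs_sub (f y) (⨍ z in closedBall x (2 * r), f z)
    linarith

section Cube

variable {n : ℕ}

lemma cube_eq_preimage (x : Rn n) {l : ℝ} (hl : 0 ≤ l) :
    cube n x l = (WithLp.ofLp : Rn n → Fin n → ℝ) ⁻¹' closedBall x.ofLp (l / 2) := by
  ext y
  simp [cube, dist_pi_le_iff (show 0 ≤ l / 2 by positivity), Real.dist_eq]

lemma measurableEmbedding_ofLp : MeasurableEmbedding (WithLp.ofLp : Rn n → Fin n → ℝ) :=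
  (MeasurableEquiv.toLp 2 (Fin n → ℝ)).symm.measurableEmbedding

lemma setIntegral_cube (g : Rn n → ℝ) (x : Rn n) {l : ℝ} (hl : 0 ≤ l) :
    ∫ y in cube n x l, g y = ∫ z in closedBall x.ofLp (l / 2), g (WithLp.toLp 2 z) := by
  rw [cube_eq_preimage x hl]
  exact (PiLp.volume_preserving_ofLp (Fin n)).setIntegral_preimage_emb measurableEmbedding_ofLp
    (fun z => g (WithLp.toLp 2 z)) _

lemma setLIntegral_cube (g : Rn n → ENNReal) (x : Rn n) {l : ℝ} (hl : 0 ≤ l) :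
    ∫⁻ y in cube n x l, g y = ∫⁻ z in closedBall x.ofLp (l / 2), g (WithLp.toLp 2 z) := by
  rw [cube_eq_preimage x hl]
  exact (PiLp.volume_preserving_ofLp (Fin n)).setLIntegral_comp_preimage_emb
    measurableEmbedding_ofLp (fun z => g (WithLp.toLp 2 z)) _

lemma locallyIntegrable_comp_toLp {f : Rn n → ℝ} (hf : LocallyIntegrable f volume) :
    LocallyIntegrable (fun z : Fin n → ℝ => f (WithLp.toLp 2 z)) volume := by
  have h := (PiLp.volume_preserving_toLp (Fin n)).map_eq
  rw [← h] at hf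
  exact (locallyIntegrable_map_homeomorph
    (PiLp.homeomorph 2 (fun _ : Fin n => ℝ)).symm).1 hf

lemma cubeAvg_eq_setAverage (f : Rn n → ℝ) (x : Rn n) {l : ℝ} (hl : 0 < l) :
    cubeAvg n f x l = ⨍ z in closedBall x.ofLp (l / 2), f (WithLp.toLp 2 z) := by
  rw [cubeAvg, setIntegral_cube f x hl.le, setAverage_eq, measureReal_def,
    Real.volume_pi_closedBall _ (by positivity), ENNReal.toReal_ofReal (by positivity),
    Fintype.card_fin, mul_div_cancel₀ l two_ne_zero, smul_eq_mul, one_div]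

lemma lintegral_sub_average_le {V f : Rn n → ℝ} (hf : LocallyIntegrable f volume) {N : ℝ}
    (hB : IsBMOLBound n V f N) (x : Fin n → ℝ) {r : ℝ} (hr : 0 < r) :
    ∫⁻ y in closedBall x r, ‖f (WithLp.toLp 2 y) -
        ⨍ z in closedBall x r, f (WithLp.toLp 2 z)‖ₑ ≤
      ENNReal.ofReal (N * (2 * r) ^ Fintype.card (Fin n)) := by
  have hl : 0 < 2 * r := by positivity
  have h := hB.1 (WithLp.toLp 2 x) (2 * r) hl
  rw [setIntegral_cube _ _ hl.le, cubeAvg_eq_setAverage f _ hl, mul_div_cancel_left₀ r two_ne_zero,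
    one_div, inv_mul_le_iff₀ (by positivity)] at h
  have hint : IntegrableOn (fun y => f (WithLp.toLp 2 y) -
      ⨍ z in closedBall x r, f (WithLp.toLp 2 z)) (closedBall x r) :=
    ((locallyIntegrable_comp_toLp hf).integrableOn_isCompact (isCompact_closedBall x r)).sub
      (integrableOn_const measure_closedBall_lt_top.ne)
  rw [← ofReal_integral_norm_eq_lintegral_enorm hint, Fintype.card_fin, mul_comm N]
  exact ENNReal.ofReal_le_ofReal h

lemma abs_cubeAvg_le {V f : Rn n → ℝ} {N : ℝ} (hB : IsBMOLBound n V f N) {x : Rn n} {l : ℝ}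
    (hl : 0 < l) (hV : critRho n V x ≤ l) : |cubeAvg n f x l| ≤ N := by
  refine le_trans ?_ (hB.2 x l hl hV)
  rw [cubeAvg, abs_mul, abs_of_pos (show 0 < 1 / l ^ n by positivity)]
  gcongr
  exact abs_integral_le_integral_abs

lemma IsBMOLBound.mono {V f : Rn n → ℝ} {N N' : ℝ} (hB : IsBMOLBound n V f N) (h : N ≤ N') :
    IsBMOLBound n V f N' :=
  ⟨fun x l hl => (hB.1 x l hl).trans h, fun x l hl hx => (hB.2 x l hl hx).trans h⟩

lemma lintegral_rpow_cube_le {V f : Rn n → ℝ} (hf : LocallyIntegrable f volume) {N : ℝ}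
    (hN : 0 < N) (hB : IsBMOLBound n V f N) {p : ℝ} (hp : 1 ≤ p) {x : Rn n} {l : ℝ}
    (hl : 0 < l) (hV : critRho n V x ≤ l) :
    ∫⁻ y in cube n x l, ENNReal.ofReal (|f y| ^ p) ≤
      ENNReal.ofReal ((2 * 8 ^ n * N) ^ p * geomMoment p * l ^ n) := by
  have ha := abs_cubeAvg_le hB (show 0 < 2 * l by positivity) (by linarith : critRho n V x ≤ 2 * l)
  rw [cubeAvg_eq_setAverage f x (by positivity), mul_div_assoc] at ha
  have h := lintegral_rpow_closedBall_le (locallyIntegrable_comp_toLp hf) hN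
    (fun x r hr => lintegral_sub_average_le hf hB x hr) hp (half_pos hl) ha
  rwa [Fintype.card_fin, mul_div_cancel₀ l two_ne_zero,
    ← setLIntegral_cube (fun y => ENNReal.ofReal (|f y| ^ p)) x hl.le] at h

lemma integrableOn_rpow_cube_and_le {V f : Rn n → ℝ} (hf : LocallyIntegrable f volume) {N : ℝ}
    (hN : 0 < N) (hB : IsBMOLBound n V f N) {p : ℝ} (hp : 1 ≤ p) {x : Rn n} {l : ℝ}
    (hl : 0 < l) (hV : critRho n V x ≤ l) :
    IntegrableOn (fun y => |f y| ^ p) (cube n x l) volume ∧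
      ((1 / l ^ n) * ∫ y in cube n x l, |f y| ^ p) ^ (1 / p) ≤
        2 * 8 ^ n * geomMoment p ^ (1 / p) * N := by
  have h := lintegral_rpow_cube_le hf hN hB hp hl hV
  have hK := (geomMoment_pos p).le
  have hnn : ∀ y, 0 ≤ |f y| ^ p := fun y => by positivity
  have hmeas : AEStronglyMeasurable (fun y => |f y| ^ p) (volume.restrict (cube n x l)) :=
    (hf.aestronglyMeasurable.aemeasurable.abs.pow_const p).aestronglyMeasurable.restrict
  refine ⟨⟨hmeas, ?_⟩, ?_⟩
  · rw [hasFiniteIntegral_iff_ofReal (Filter.Eventually.of_forall hnn)]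
    exact h.trans_lt ENNReal.ofReal_lt_top
  · have hint : ∫ y in cube n x l, |f y| ^ p ≤ (2 * 8 ^ n * N) ^ p * geomMoment p * l ^ n := by
      rw [integral_eq_lintegral_of_nonneg_ae (Filter.Eventually.of_forall hnn) hmeas]
      exact ENNReal.toReal_le_of_le_ofReal (by positivity) h
    have hle : (1 / l ^ n) * ∫ y in cube n x l, |f y| ^ p ≤
        (2 * 8 ^ n * N) ^ p * geomMoment p := by
      rw [one_div, inv_mul_le_iff₀ (by positivity)]
      linarith
    have h0 : 0 ≤ (1 / l ^ n) * ∫ y in cube n x l, |f y| ^ p :=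
      mul_nonneg (by positivity) (integral_nonneg hnn)
    refine (Real.rpow_le_rpow h0 hle (by positivity)).trans_eq ?_
    rw [Real.mul_rpow (by positivity) hK, ← Real.rpow_mul (by positivity),
      mul_one_div_cancel (by linarith), Real.rpow_one]
    ring

end Cube

/-- `L^p` bound for `BMO_L` on large cubes: for every `p ∈ [1,∞)` there is a constant `C`
such that for every `f ∈ BMO_L` and every cube `Q` with center `x` and sidelength
`l ≥ ρ(x)`, `((1/|Q|) ∫_Q |f|^p)^{1/p} ≤ C ‖f‖_{BMO_L}`. -/
theorem bmoL_Lp_large_cube_bound (n : ℕ) (hn : 3 ≤ n) (V : Rn n → ℝ) (q : ℝ)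
    (hq : (n : ℝ) / 2 ≤ q) (hV : IsReverseHolder n V q)
    (hV0 : ¬ V =ᵐ[(volume : Measure (Rn n))] 0) :
    ∀ p : ℝ, 1 ≤ p → ∃ C > 0, ∀ f : Rn n → ℝ, LocallyIntegrable f volume →
      ∀ N : ℝ, 0 ≤ N → IsBMOLBound n V f N →
      ∀ (x : Rn n) (l : ℝ), 0 < l → critRho n V x ≤ l →
        IntegrableOn (fun y => |f y| ^ p) (cube n x l) volume ∧
        ((1 / l ^ n) * ∫ y in cube n x l, |f y| ^ p) ^ (1 / p) ≤ C * N := by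
  intro p hp
  have hK := geomMoment_pos p
  refine ⟨2 * 8 ^ n * geomMoment p ^ (1 / p), by positivity, ?_⟩
  intro f hf N hN hB x l hl hx
  refine ⟨(integrableOn_rpow_cube_and_le hf (by linarith : 0 < N + 1)
    (hB.mono (by linarith)) hp hl hx).1, ?_⟩
  refine ge_of_tendsto (x := nhdsWithin N (Set.Ioi N))
    (f := fun N' => 2 * 8 ^ n * geomMoment p ^ (1 / p) * N') ?_ ?_
  · exact (Continuous.tendsto (by fun_prop) N).mono_left nhdsWithin_le_nhds
  · filter_upwards [self_mem_nhdsWithin] with N' hN'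
    exact (integrableOn_rpow_cube_and_le hf (hN.trans_lt hN') (hB.mono (le_of_lt hN')) hp hl hx).2
end
end
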